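/- Let S, T be finite subsets of Fin n and c, d : Bool. Define the affine functions f I = c XOR (⊕_{i ∈ S} I i) and g I = d XOR (⊕_{i ∈ T} I i). Then f is isomorphic to g if and only if c = d and S and T have the same cardinality. -/

import Mathlib

/-- Finite sets of equal cardinality are related by a permutation of the ambient finite type. -/
theorem exists_perm_map_eq_of_card_eq {α : Type*} [Fintype α] [DecidableEq α]
    {S T : Finset α} (h : S.card = T.card) :
    ∃ π : Equiv.Perm α, T.map π.toEmbedding = S := by
  let e : {x // x ∈ T} ≃ {x // x ∈ S} := Finset.equivOfCardEq h.symm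
  refine ⟨e.extendSubtype, Finset.eq_of_subset_of_card_le ?_ (by simp [h])⟩
  intro x hx
  obtain ⟨y, hy, rfl⟩ := Finset.mem_map.mp hx
  exact e.extendSubtype_mem y hy

/-- Permuting the inputs of a parity amounts to permuting its set of coordinates. -/
theorem card_filter_comp_perm {α : Type*} (T : Finset α) (π : Equiv.Perm α) (I : α → Bool) :
    (T.filter (fun i => (I ∘ π) i = true)).card =
      ((T.map π.toEmbedding).filter (fun i => I i = true)).card := by
  rw [Finset.filter_map, Finset.card_map]
  rfl

/-- An affine Boolean function determines its constant term and its set of coordinates. -/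
theorem affine_bool_injective {α : Type*} [DecidableEq α] {S T : Finset α} {c d : Bool}
    (h : ∀ I : α → Bool,
      xor c (decide (Odd (S.filter (fun i => I i = true)).card)) =
        xor d (decide (Odd (T.filter (fun i => I i = true)).card))) :
    c = d ∧ S = T := by
  have hcd : c = d := by simpa using h (fun _ => false)
  refine ⟨hcd, ?_⟩
  subst hcd
  ext j
  have hj := h (fun i => decide (i = j))
  simp only [decide_eq_true_eq, Finset.filter_eq', Bool.xor_right_inj] at hj
  by_cases hS : j ∈ S <;> by_cases hT : j ∈ T <;> simp_all

/-- The affine function `f I = c ⊕ (⊕_{i ∈ S} I i)` is isomorphic to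
`g I = d ⊕ (⊕_{i ∈ T} I i)` iff `c = d` and `|S| = |T|`. -/
theorem stmt_15 (n : ℕ) (S T : Finset (Fin n)) (c d : Bool)
    (f g : (Fin n → Bool) → Bool)
    (hf : ∀ I : Fin n → Bool,
      f I = xor c (decide (Odd (S.filter (fun i => I i = true)).card)))
    (hg : ∀ I : Fin n → Bool,
      g I = xor d (decide (Odd (T.filter (fun i => I i = true)).card))) :
    (∃ π : Equiv.Perm (Fin n), ∀ I : Fin n → Bool, f I = g (I ∘ π)) ↔
    (c = d ∧ S.card = T.card) := by
  simp only [hf, hg, card_filter_comp_perm]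
  constructor
  · rintro ⟨π, hπ⟩
    obtain ⟨hcd, hST⟩ := affine_bool_injective hπ
    exact ⟨hcd, by simp [hST]⟩
  · rintro ⟨rfl, hST⟩
    obtain ⟨π, hπ⟩ := exists_perm_map_eq_of_card_eq hST
    exact ⟨π, fun I => by rw [hπ]⟩
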